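/- For twist angle φ = π, every N ≥ 1, all nonzero complex w₁,…,w_N and every nonzero complex z, the transfer matrix of the nineteen-vertex model satisfies T^{(2)}(z|w₁,…,w_N) |Ψ(w₁,…,w_N)⟩ = (−1)^{N+1} (∏_{j=1}^N [q w_j/z][q² z/w_j]) |Ψ(w₁,…,w_N)⟩. In particular, whenever |Ψ(w₁,…,w_N)⟩ ≠ 0, the transfer matrix T^{(2)}(z) possesses the simple explicit eigenvalue θ^{(2)}(z) = (−1)^{N+1} ∏_{j=1}^N [q w_j/z][q² z/w_j]. -/

import Mathlib

open Matrix BigOperators Finset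

noncomputable section

/-- `[z] = z - z⁻¹`. -/
def br (z : ℂ) : ℂ := z - z⁻¹

/-- R-matrix `R^{(1,2)}(z)` on ℂ²⊗ℂ³; basis `(ε, σ)` with ε ∈ {0=↑,1=↓}, σ ∈ {0=⇑,1=0,2=⇓}. -/
def R12 (q c z : ℂ) : Matrix (Fin 2 × Fin 3) (Fin 2 × Fin 3) ℂ :=
  Matrix.of fun p p' =>
    if p = (0,0) ∧ p' = (0,0) then br (q^2*z)
    else if p = (0,1) ∧ p' = (0,1) then br (q*z)
    else if p = (0,2) ∧ p' = (0,2) then br z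
    else if p = (1,0) ∧ p' = (1,0) then br z
    else if p = (1,1) ∧ p' = (1,1) then br (q*z)
    else if p = (1,2) ∧ p' = (1,2) then br (q^2*z)
    else if p = (0,1) ∧ p' = (1,0) then c
    else if p = (0,2) ∧ p' = (1,1) then c
    else if p = (1,0) ∧ p' = (0,1) then c
    else if p = (1,1) ∧ p' = (0,2) then c
    else 0

/-- `R^{(1,2)}` acting on the auxiliary ℂ² and the j-th site of `(ℂ³)^{⊗N}`. -/
def R12at (q c z : ℂ) {N : ℕ} (j : Fin N) :
    Matrix (Fin 2 × (Fin N → Fin 3)) (Fin 2 × (Fin N → Fin 3)) ℂ :=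
  Matrix.of fun p p' =>
    R12 q c z (p.1, p.2 j) (p'.1, p'.2 j) *
      if ∀ k, k ≠ j → p.2 k = p'.2 k then 1 else 0

/-- Monodromy matrix `𝒯_a(z) = R^{(1,2)}_{a,N}(q⁻¹z/w_N) ⋯ R^{(1,2)}_{a,1}(q⁻¹z/w₁)`. -/
def monodromy (q c : ℂ) {N : ℕ} (w : Fin N → ℂ) (z : ℂ) :
    Matrix (Fin 2 × (Fin N → Fin 3)) (Fin 2 × (Fin N → Fin 3)) ℂ :=
  (((List.finRange N).reverse).map fun j => R12at q c (q⁻¹ * z / w j) j).prod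

/-- The operator 𝒜(z): auxiliary block (↑,↑) of the monodromy matrix. -/
def Aop (q c : ℂ) {N : ℕ} (w : Fin N → ℂ) (z : ℂ) :
    Matrix (Fin N → Fin 3) (Fin N → Fin 3) ℂ :=
  Matrix.of fun σ τ => monodromy q c w z (0, σ) (0, τ)

/-- The operator ℬ(z): auxiliary block (↑,↓) of the monodromy matrix. -/
def Bop (q c : ℂ) {N : ℕ} (w : Fin N → ℂ) (z : ℂ) :
    Matrix (Fin N → Fin 3) (Fin N → Fin 3) ℂ :=
  Matrix.of fun σ τ => monodromy q c w z (0, σ) (1, τ)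

/-- The operator 𝒟(z): auxiliary block (↓,↓) of the monodromy matrix. -/
def Dop (q c : ℂ) {N : ℕ} (w : Fin N → ℂ) (z : ℂ) :
    Matrix (Fin N → Fin 3) (Fin N → Fin 3) ℂ :=
  Matrix.of fun σ τ => monodromy q c w z (1, σ) (1, τ)

/-- Bethe reference state `|∧⟩ = |⇑…⇑⟩`. -/
def vac (N : ℕ) : (Fin N → Fin 3) → ℂ := fun σ => if σ = fun _ => 0 then 1 else 0

/-- Bethe vector `|Ψ(w₁,…,w_N)⟩ = ℬ(w₁)⋯ℬ(w_N)|∧⟩`. -/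
def bethe (q c : ℂ) {N : ℕ} (w : Fin N → ℂ) : (Fin N → Fin 3) → ℂ :=
  (((List.finRange N).map fun j => Bop q c w (w j)).prod).mulVec (vac N)

/-- Nineteen-vertex R-matrix on ℂ³⊗ℂ³ (basis 0=⇑, 1=0, 2=⇓). -/
def R19 (q z : ℂ) : Matrix (Fin 3 × Fin 3) (Fin 3 × Fin 3) ℂ :=
  Matrix.of fun p p' =>
    if p = (0,0) ∧ p' = (0,0) then br (q*z) * br (q^2*z)
    else if p = (2,2) ∧ p' = (2,2) then br (q*z) * br (q^2*z)
    else if p = (0,2) ∧ p' = (0,2) then br (q⁻¹*z) * br z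
    else if p = (2,0) ∧ p' = (2,0) then br (q⁻¹*z) * br z
    else if p = (0,2) ∧ p' = (2,0) then br q * br (q^2)
    else if p = (2,0) ∧ p' = (0,2) then br q * br (q^2)
    else if p = (0,1) ∧ p' = (0,1) then br z * br (q*z)
    else if p = (1,0) ∧ p' = (1,0) then br z * br (q*z)
    else if p = (1,2) ∧ p' = (1,2) then br z * br (q*z)
    else if p = (2,1) ∧ p' = (2,1) then br z * br (q*z)
    else if p = (0,1) ∧ p' = (1,0) then br (q^2) * br (q*z)
    else if p = (1,0) ∧ p' = (0,1) then br (q^2) * br (q*z)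
    else if p = (1,2) ∧ p' = (2,1) then br (q^2) * br (q*z)
    else if p = (2,1) ∧ p' = (1,2) then br (q^2) * br (q*z)
    else if p = (1,1) ∧ p' = (0,2) then br (q^2) * br z
    else if p = (1,1) ∧ p' = (2,0) then br (q^2) * br z
    else if p = (0,2) ∧ p' = (1,1) then br (q^2) * br z
    else if p = (2,0) ∧ p' = (1,1) then br (q^2) * br z
    else if p = (1,1) ∧ p' = (1,1) then br z * br (q*z) + br q * br (q^2)
    else 0

/-- `R(z)` acting on the auxiliary ℂ³ and the j-th site of `(ℂ³)^{⊗N}`. -/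
def R19at (q z : ℂ) {N : ℕ} (j : Fin N) :
    Matrix (Fin 3 × (Fin N → Fin 3)) (Fin 3 × (Fin N → Fin 3)) ℂ :=
  Matrix.of fun p p' =>
    R19 q z (p.1, p.2 j) (p'.1, p'.2 j) *
      if ∀ k, k ≠ j → p.2 k = p'.2 k then 1 else 0

/-- The twist Ω (given by its diagonal `d`) acting on the auxiliary ℂ³. -/
def omegaAux (d : Fin 3 → ℂ) {N : ℕ} :
    Matrix (Fin 3 × (Fin N → Fin 3)) (Fin 3 × (Fin N → Fin 3)) ℂ :=
  Matrix.of fun p p' => if p = p' then d p.1 else 0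

/-- Transfer matrix `T^{(2)}(z|w₁,…,w_N)` of the nineteen-vertex model with twist diagonal `d`:
the partial trace over the auxiliary space of `Ω_a R_{a,N}(z/w_N) ⋯ R_{a,1}(z/w₁)`. -/
def T2 (q : ℂ) (d : Fin 3 → ℂ) {N : ℕ} (w : Fin N → ℂ) (z : ℂ) :
    Matrix (Fin N → Fin 3) (Fin N → Fin 3) ℂ :=
  Matrix.of fun σ τ =>
    ∑ a : Fin 3,
      ((omegaAux d * (((List.finRange N).reverse).map fun j => R19at q (z / w j) j).prod :
        Matrix (Fin 3 × (Fin N → Fin 3)) (Fin 3 × (Fin N → Fin 3)) ℂ)) (a, σ) (a, τ)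

/-! ### Operators acting on one site -/

/-- The operator acting as `M` on site `j` of `(ℂ³)^{⊗N}`. -/
def siteMat {N : ℕ} (j : Fin N) (M : Matrix (Fin 3) (Fin 3) ℂ) :
    Matrix (Fin N → Fin 3) (Fin N → Fin 3) ℂ :=
  Matrix.of fun σ τ => M (σ j) (τ j) * if ∀ k, k ≠ j → σ k = τ k then 1 else 0

lemma siteMat_mulVec {N : ℕ} (j : Fin N) (M : Matrix (Fin 3) (Fin 3) ℂ)
    (f : (Fin N → Fin 3) → ℂ) (σ : Fin N → Fin 3) :
    (siteMat j M *ᵥ f) σ = ∑ x, M (σ j) x * f (Function.update σ j x) := by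
  symm
  refine Finset.sum_of_injOn (fun x => Function.update σ j x) ?_ ?_ ?_ ?_
  · exact (Function.update_injective σ j).injOn
  · intro x _; simp
  · intro τ _ h
    have h' : ¬ ∀ k, k ≠ j → σ k = τ k := by
      intro hk
      apply h
      refine ⟨τ j, by simp, ?_⟩
      funext k
      by_cases hkj : k = j
      · subst hkj; simp
      · simp [hkj, hk k hkj]
    simp [siteMat, h']
  · intro x _
    have h' : ∀ k, k ≠ j → σ k = Function.update σ j x k := by
      intro k hk; simp [hk]
    simp only [siteMat, Matrix.of_apply, Function.update_self]
    rw [if_pos h', mul_one]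

lemma siteMat_one {N : ℕ} (j : Fin N) : siteMat j 1 = 1 := by
  apply Matrix.mulVec_injective
  funext f σ
  simp [siteMat_mulVec, Matrix.one_apply]

lemma siteMat_mul {N : ℕ} (j : Fin N) (M M' : Matrix (Fin 3) (Fin 3) ℂ) :
    siteMat j (M * M') = siteMat j M * siteMat j M' := by
  apply Matrix.mulVec_injective
  funext f σ
  rw [← Matrix.mulVec_mulVec]
  simp only [siteMat_mulVec, Matrix.mul_apply, Function.update_self, Function.update_idem,
    Finset.sum_mul, Finset.mul_sum, mul_assoc]
  exact Finset.sum_comm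

/-- The embedding of the operators on site `j` as an algebra homomorphism. -/
def site {N : ℕ} (j : Fin N) :
    Matrix (Fin 3) (Fin 3) ℂ →ₐ[ℂ] Matrix (Fin N → Fin 3) (Fin N → Fin 3) ℂ :=
  AlgHom.ofLinearMap
    { toFun := siteMat j
      map_add' := fun M M' => by
        ext σ τ
        simp only [siteMat, Matrix.of_apply, Matrix.add_apply, add_mul]
      map_smul' := fun a M => by ext σ τ; simp [siteMat] }
    (siteMat_one j) (siteMat_mul j)

lemma site_mulVec {N : ℕ} (j : Fin N) (M : Matrix (Fin 3) (Fin 3) ℂ)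
    (f : (Fin N → Fin 3) → ℂ) (σ : Fin N → Fin 3) :
    (site j M *ᵥ f) σ = ∑ x, M (σ j) x * f (Function.update σ j x) :=
  siteMat_mulVec j M f σ

lemma commute_site {N : ℕ} {i j : Fin N} (h : i ≠ j) (M M' : Matrix (Fin 3) (Fin 3) ℂ) :
    Commute (site i M) (site j M') := by
  apply Matrix.mulVec_injective
  funext f σ
  rw [← Matrix.mulVec_mulVec, ← Matrix.mulVec_mulVec]
  simp only [site_mulVec, Function.update_of_ne h, Function.update_of_ne h.symm, Finset.mul_sum]
  rw [Finset.sum_comm]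
  refine Finset.sum_congr rfl fun x _ => Finset.sum_congr rfl fun y _ => ?_
  rw [Function.update_comm h]
  ring

/-! ### Two copies of the auxiliary space -/

section Amp

variable {m A : Type*} [Fintype m] [DecidableEq m] [Ring A]

/-- An operator-valued matrix acting on the first of two copies of the auxiliary space. -/
def amp₁ : Matrix m m A →+* Matrix (m × m) (m × m) A where
  toFun T := Matrix.of fun p p' => if p.2 = p'.2 then T p.1 p'.1 else 0
  map_one' := by ext ⟨a, b⟩ ⟨c, d⟩; simp [Matrix.one_apply, Prod.ext_iff]; grind
  map_zero' := by ext; simp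
  map_add' T S := by ext ⟨a, b⟩ ⟨c, d⟩; simp; grind
  map_mul' T S := by
    ext ⟨a, b⟩ ⟨c, d⟩
    simp [Matrix.mul_apply, Fintype.sum_prod_type]

/-- An operator-valued matrix acting on the second of two copies of the auxiliary space. -/
def amp₂ : Matrix m m A →+* Matrix (m × m) (m × m) A where
  toFun T := Matrix.of fun p p' => if p.1 = p'.1 then T p.2 p'.2 else 0
  map_one' := by ext ⟨a, b⟩ ⟨c, d⟩; simp [Matrix.one_apply, Prod.ext_iff]; grind
  map_zero' := by ext; simp
  map_add' T S := by ext ⟨a, b⟩ ⟨c, d⟩; simp; grind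
  map_mul' T S := by
    ext ⟨a, b⟩ ⟨c, d⟩
    simp [Matrix.mul_apply, Fintype.sum_prod_type]

lemma amp₁_mul_amp₂ (T S : Matrix m m A) (p p' : m × m) :
    (amp₁ T * amp₂ S) p p' = T p.1 p'.1 * S p.2 p'.2 := by
  simp [amp₁, amp₂, Matrix.mul_apply, Fintype.sum_prod_type]

lemma amp₂_mul_amp₁ (T S : Matrix m m A) (p p' : m × m) :
    (amp₂ S * amp₁ T) p p' = S p.2 p'.2 * T p.1 p'.1 := by
  simp [amp₁, amp₂, Matrix.mul_apply, Fintype.sum_prod_type]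

lemma commute_amp {T S : Matrix m m A} (h : ∀ a b c d, Commute (T a b) (S c d)) :
    Commute (amp₁ T) (amp₂ S) := by
  ext p p'
  rw [amp₁_mul_amp₂, amp₂_mul_amp₁]
  exact h _ _ _ _

end Amp

lemma list_prod_mul_distrib {ι M : Type*} [Monoid M] (x y : ι → M) (l : List ι) (hl : l.Nodup)
    (h : ∀ i j, i ≠ j → Commute (x i) (y j)) :
    (l.map fun i => x i * y i).prod = (l.map x).prod * (l.map y).prod := by
  induction l with
  | nil => simp
  | cons i l ih =>
    obtain ⟨hi, hl⟩ := List.nodup_cons.1 hl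
    have hc : Commute (y i) (l.map x).prod := by
      refine Commute.list_prod_right _ _ fun a ha => ?_
      obtain ⟨j, hj, rfl⟩ := List.mem_map.1 ha
      exact (h j i fun e => hi (e ▸ hj)).symm
    simp only [List.map_cons, List.prod_cons, ih hl]
    rw [mul_assoc, ← mul_assoc (y i), hc.eq]
    simp only [mul_assoc]

lemma list_prod_intertwine {ι m n A : Type*} [Fintype m] [DecidableEq m] [Fintype n]
    [DecidableEq n] [Ring A] (V : Matrix m n A) (X : ι → Matrix m m A) (Y : ι → Matrix n n A)
    (h : ∀ i, X i * V = V * Y i) (l : List ι) :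
    (l.map X).prod * V = V * (l.map Y).prod := by
  induction l with
  | nil => simp
  | cons i l ih =>
    simp only [List.map_cons, List.prod_cons]
    rw [Matrix.mul_assoc, ih, ← Matrix.mul_assoc, h, Matrix.mul_assoc]

/-! ### Off-shell action on Bethe vectors -/

lemma offShell {E ι P : Type*} [AddCommGroup E] [Module ℂ E] [DecidableEq ι]
    (X B : P → Module.End ℂ E) (x : P → ℂ) (f g : P → P → ℂ) (good : P → P → Prop)
    (hBB : ∀ y u, Commute (B y) (B u))
    (hXB : ∀ y u, good y u → X y * B u = f y u • (B u * X y) + g y u • (B y * X u))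
    (hfg : ∀ y u t, good y u → good y t → good u t → good t u →
      f y u * g y t + g y u * g u t = g y t * f t u)
    (u : ι → P) (hu : ∀ i j, i ≠ j → good (u i) (u j)) (β : Finset ι → E)
    (hβ0 : ∀ y, X y (β ∅) = x y • β ∅)
    (hβ : ∀ i S, i ∉ S → β (insert i S) = B (u i) (β S)) (S : Finset ι) :
    ∀ y, (∀ i ∈ S, good y (u i)) →
    X y (β S) = (x y * ∏ i ∈ S, f y (u i)) • β S +
      ∑ i ∈ S, (x (u i) * g y (u i) * ∏ k ∈ S.erase i, f (u i) (u k)) •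
        B y (β (S.erase i)) := by
  induction S using Finset.induction_on with
  | empty => intro y _; simp [hβ0]
  | insert i S hi ih =>
    intro y hy
    have h1 := ih y fun j hj => hy j (Finset.mem_insert_of_mem hj)
    have h2 := ih (u i) fun j hj => hu i j fun e => hi (e ▸ hj)
    have hyi := hy i (Finset.mem_insert_self i S)
    have h3 := LinearMap.congr_fun (hXB y (u i) hyi) (β S)
    simp only [Module.End.mul_apply, LinearMap.add_apply, LinearMap.smul_apply] at h3
    rw [hβ i S hi, h3, h1, h2, Finset.sum_insert hi, Finset.prod_insert hi,
      Finset.erase_insert hi]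
    simp only [map_add, map_smul, map_sum, smul_add, Finset.smul_sum, smul_smul]
    have key : ∀ j ∈ S,
        (x (u j) * g y (u j) * ∏ k ∈ (insert i S).erase j, f (u j) (u k)) •
          B y (β ((insert i S).erase j)) =
        (f y (u i) * (x (u j) * g y (u j) * ∏ k ∈ S.erase j, f (u j) (u k))) •
          B (u i) (B y (β (S.erase j))) +
        (g y (u i) * (x (u j) * g (u i) (u j) * ∏ k ∈ S.erase j, f (u j) (u k))) •
          B y (B (u i) (β (S.erase j))) := by
      intro j hj
      have hij : i ≠ j := fun e => hi (e ▸ hj)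
      have hi' : i ∉ S.erase j := fun e => hi (Finset.mem_of_mem_erase e)
      have hb : B (u i) (B y (β (S.erase j))) = B y (B (u i) (β (S.erase j))) :=
        LinearMap.congr_fun (hBB (u i) y).eq _
      have hf := hfg y (u i) (u j) hyi (hy j (Finset.mem_insert_of_mem hj)) (hu _ _ hij)
        (hu _ _ hij.symm)
      rw [Finset.erase_insert_of_ne hij, Finset.prod_insert hi', hβ i _ hi', hb, ← add_smul]
      congr 1
      linear_combination (-(x (u j)) * ∏ k ∈ S.erase j, f (u j) (u k)) * hf
    rw [Finset.sum_congr rfl key, Finset.sum_add_distrib]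
    have e1 : f y (u i) * (x y * ∏ j ∈ S, f y (u j)) = x y * (f y (u i) * ∏ j ∈ S, f y (u j)) := by
      ring
    have e2 : g y (u i) * (x (u i) * ∏ j ∈ S, f (u i) (u j)) =
        x (u i) * g y (u i) * ∏ j ∈ S, f (u i) (u j) := by
      ring
    rw [e1, e2]
    abel

/-! ### Local relations -/

/-- `R^{(1,2)}(z)` as a matrix over the auxiliary space with values in the operators on ℂ³. -/
def laxLocal (q c z : ℂ) : Matrix (Fin 2) (Fin 2) (Matrix (Fin 3) (Fin 3) ℂ) :=
  !![!![br (q^2*z), 0, 0; 0, br (q*z), 0; 0, 0, br z], !![0, 0, 0; c, 0, 0; 0, c, 0];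
     !![0, c, 0; 0, 0, c; 0, 0, 0], !![br z, 0, 0; 0, br (q*z), 0; 0, 0, br (q^2*z)]]

lemma R12_apply (q c z : ℂ) (a b : Fin 2) (s t : Fin 3) :
    R12 q c z (a, s) (b, t) = laxLocal q c z a b s t := by
  fin_cases a <;> fin_cases b <;> fin_cases s <;> fin_cases t <;> simp [R12, laxLocal]

/-- The six-vertex R-matrix. -/
def R11 (q x : ℂ) : Matrix (Fin 2 × Fin 2) (Fin 2 × Fin 2) ℂ :=
  Matrix.of fun p p' =>
    (if p = p' then (if p.1 = p.2 then br (q * x) else br x) else 0) +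
      (if p ≠ p' ∧ p.1 = p'.2 ∧ p.2 = p'.1 then br q else 0)

/-- The embedding of ℂ³ as the triplet in ℂ²⊗ℂ², with middle vector of weight `κ`. -/
def triplet (κ : ℂ) : Matrix (Fin 2 × Fin 2) (Fin 3) ℂ :=
  Matrix.of fun p a => if p = (0, 0) ∧ a = 0 then 1 else if p = (1, 1) ∧ a = 2 then 1
    else if p.1 ≠ p.2 ∧ a = 1 then κ else 0

/-- The singlet covector on ℂ²⊗ℂ². -/
def singlet : Matrix Unit (Fin 2 × Fin 2) ℂ :=
  Matrix.of fun _ p => if p = (0, 1) then 1 else if p = (1, 0) then -1 else 0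

/-- `R(z)` as a matrix over the auxiliary space with values in the operators on ℂ³. -/
def R19Local (q z : ℂ) : Matrix (Fin 3) (Fin 3) (Matrix (Fin 3) (Fin 3) ℂ) :=
  Matrix.of fun a b => Matrix.of fun s t => R19 q z (a, s) (b, t)

set_option maxHeartbeats 4000000 in
lemma rtt_local (q c x v : ℂ) (hq : q ≠ 0) (hx : x ≠ 0) (hv : v ≠ 0)
    (hc : c * c = br q * br (q^2)) :
    ((amp₂ (laxLocal q c v) * amp₁ (laxLocal q c (x * v))) *
      (R11 q x).map (algebraMap ℂ (Matrix (Fin 3) (Fin 3) ℂ))) =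
    (R11 q x).map (algebraMap ℂ _) *
      (amp₁ (laxLocal q c (x * v)) * amp₂ (laxLocal q c v)) := by
  ext1 ⟨a, b⟩ ⟨e, f⟩
  rw [Matrix.mul_apply, Matrix.mul_apply]
  simp only [amp₂_mul_amp₁, amp₁_mul_amp₂, Fintype.sum_prod_type, Fin.sum_univ_two,
    Matrix.map_apply, Algebra.algebraMap_eq_smul_one, mul_smul_comm, smul_mul_assoc, mul_one,
    one_mul]
  fin_cases a <;> fin_cases b <;> fin_cases e <;> fin_cases f <;>
  simp [laxLocal, R11, hc]
  all_goals constructorm* _ ∧ _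
  all_goals first
    | (left; ring)
    | (funext i; fin_cases i <;> rfl)
    | (simp only [br]; field_simp; ring1)

lemma R19Local_eq (q z : ℂ) : R19Local q z =
    !![!![br (q*z) * br (q^2*z), 0, 0; 0, br z * br (q*z), 0; 0, 0, br (q⁻¹*z) * br z],
       !![0, 0, 0; br (q^2) * br (q*z), 0, 0; 0, br (q^2) * br z, 0],
       !![0, 0, 0; 0, 0, 0; br q * br (q^2), 0, 0];
       !![0, br (q^2) * br (q*z), 0; 0, 0, br (q^2) * br z; 0, 0, 0],
       !![br z * br (q*z), 0, 0; 0, br z * br (q*z) + br q * br (q^2), 0; 0, 0, br z * br (q*z)],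
       !![0, 0, 0; br (q^2) * br z, 0, 0; 0, br (q^2) * br (q*z), 0];
       !![0, 0, br q * br (q^2); 0, 0, 0; 0, 0, 0],
       !![0, br (q^2) * br z, 0; 0, 0, br (q^2) * br (q*z); 0, 0, 0],
       !![br (q⁻¹*z) * br z, 0, 0; 0, br z * br (q*z), 0; 0, 0, br (q*z) * br (q^2*z)]] := by
  ext a b s t
  fin_cases a <;> fin_cases b <;> fin_cases s <;> fin_cases t <;> rfl

lemma fusion_local (q c κ z : ℂ) (hq : q ≠ 0) (hz : z ≠ 0)
    (hc : c * c = br q * br (q^2)) (hκ : κ * c = br q) (hκ' : c = κ * br (q^2)) :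
    (amp₁ (laxLocal q c (q⁻¹ * z)) * amp₂ (laxLocal q c z)) *
      (triplet κ).map (algebraMap ℂ (Matrix (Fin 3) (Fin 3) ℂ)) =
    (triplet κ).map (algebraMap ℂ _) * R19Local q z := by
  have e1 : q^2 * (q⁻¹ * z) = q * z := by field_simp
  have e2 : q * (q⁻¹ * z) = z := by field_simp
  have h₁ (x y : ℂ) : κ * (x * c) + κ * (c * y) = br q * (x + y) := by rw [← hκ]; ring
  have h₂ (x y : ℂ) : κ * (c * x) + κ * (y * c) = br q * (x + y) := by rw [← hκ]; ring
  ext1 ⟨a, b⟩ e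
  rw [R19Local_eq]
  refine Matrix.mul_apply.trans (Eq.trans ?_ Matrix.mul_apply.symm)
  simp only [amp₁_mul_amp₂, Fintype.sum_prod_type, Fin.sum_univ_two, Fin.sum_univ_three,
    Matrix.map_apply, Algebra.algebraMap_eq_smul_one, mul_smul_comm, smul_mul_assoc, mul_one,
    one_mul]
  fin_cases a <;> fin_cases b <;> fin_cases e <;>
  simp [laxLocal, triplet, hc, e1, e2, h₁, h₂]
  all_goals try constructorm* _ ∧ _
  all_goals first
    | (left; ring)
    | (funext s; fin_cases s <;> rfl)
    | (rw [hκ']; ring)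
    | (simp only [br]; field_simp; done)
    | (simp only [br]; field_simp; ring1)

lemma singlet_local (q c z : ℂ) (hq : q ≠ 0) (hz : z ≠ 0) (hc : c * c = br q * br (q^2)) :
    algebraMap ℂ (Matrix Unit Unit (Matrix (Fin 3) (Fin 3) ℂ)) (br (q⁻¹ * z) * br (q^2 * z)) *
      singlet.map (algebraMap ℂ (Matrix (Fin 3) (Fin 3) ℂ)) =
    singlet.map (algebraMap ℂ _) *
      (amp₁ (laxLocal q c (q⁻¹ * z)) * amp₂ (laxLocal q c z)) := by
  have e1 : q^2 * (q⁻¹ * z) = q * z := by field_simp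
  have e2 : q * (q⁻¹ * z) = z := by field_simp
  ext1 _ ⟨a, b⟩
  refine Matrix.mul_apply.trans (Eq.trans ?_ Matrix.mul_apply.symm)
  simp only [amp₁_mul_amp₂, Fintype.sum_prod_type, Fin.sum_univ_two,
    Matrix.map_apply, Algebra.algebraMap_eq_smul_one, mul_smul_comm, smul_mul_assoc, mul_one,
    one_mul]
  fin_cases a <;> fin_cases b <;>
  simp [laxLocal, singlet, hc, e1, e2, Matrix.one_fin_three]
  all_goals try constructorm* _ ∧ _
  all_goals first
    | (simp only [br]; field_simp; ring1)
    | (ext s t; fin_cases s <;> fin_cases t <;> simp [mul_comm])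


/-! ### The monodromy matrix as an operator-valued matrix -/

section Map

variable {m A A' : Type*} [Ring A] [Ring A'] [Algebra ℂ A] [Algebra ℂ A']

lemma map_mul_algHom {l n : Type*} [Fintype m] (φ : A →ₐ[ℂ] A') (T : Matrix l m A)
    (S : Matrix m n A) : (T * S).map φ = T.map φ * S.map φ :=
  Matrix.map_mul (f := (φ : A →+* A'))

lemma map_algebraMap_map {n : Type*} (φ : A →ₐ[ℂ] A') (V : Matrix m n ℂ) :
    (V.map (algebraMap ℂ A)).map φ = V.map (algebraMap ℂ A') := by
  ext a b
  simp

variable [Fintype m] [DecidableEq m]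

lemma algebraMap_map (φ : A →ₐ[ℂ] A') (r : ℂ) :
    (algebraMap ℂ (Matrix m m A) r).map φ = algebraMap ℂ (Matrix m m A') r := by
  ext a b
  simp [Matrix.algebraMap_matrix_apply, apply_ite φ]

lemma amp₁_map (φ : A →ₐ[ℂ] A') (T : Matrix m m A) : (amp₁ T).map φ = amp₁ (T.map φ) := by
  ext p p'
  simp [amp₁, apply_ite φ]

lemma amp₂_map (φ : A →ₐ[ℂ] A') (T : Matrix m m A) : (amp₂ T).map φ = amp₂ (T.map φ) := by
  ext p p'
  simp [amp₂, apply_ite φ]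

end Map

/-- The operator-valued matrix of `R^{(1,2)}(z/w_j)` acting on site `j`. -/
def lax (q c : ℂ) {N : ℕ} (w : Fin N → ℂ) (z : ℂ) (j : Fin N) :
    Matrix (Fin 2) (Fin 2) (Matrix (Fin N → Fin 3) (Fin N → Fin 3) ℂ) :=
  (laxLocal q c (z / w j)).map (site j)

/-- The operator-valued matrix of `R(z/w_j)` acting on site `j`. -/
def lax19 (q : ℂ) {N : ℕ} (w : Fin N → ℂ) (z : ℂ) (j : Fin N) :
    Matrix (Fin 3) (Fin 3) (Matrix (Fin N → Fin 3) (Fin N → Fin 3) ℂ) :=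
  (R19Local q (z / w j)).map (site j)

/-- The monodromy matrix as an operator-valued matrix, without the shift of the argument. -/
def mono (q c : ℂ) {N : ℕ} (w : Fin N → ℂ) (z : ℂ) :
    Matrix (Fin 2) (Fin 2) (Matrix (Fin N → Fin 3) (Fin N → Fin 3) ℂ) :=
  ((List.finRange N).reverse.map (lax q c w z)).prod

/-- The operator-valued monodromy matrix of the nineteen-vertex model. -/
def mono19 (q : ℂ) {N : ℕ} (w : Fin N → ℂ) (z : ℂ) :
    Matrix (Fin 3) (Fin 3) (Matrix (Fin N → Fin 3) (Fin N → Fin 3) ℂ) :=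
  ((List.finRange N).reverse.map (lax19 q w z)).prod

lemma monodromy_eq (q c : ℂ) {N : ℕ} (w : Fin N → ℂ) (z : ℂ) :
    monodromy q c w z = Matrix.compRingEquiv _ _ _ (mono q c w (q⁻¹ * z)) := by
  rw [mono, map_list_prod, List.map_map]
  have h : ∀ j, R12at q c (q⁻¹ * z / w j) j =
      (Matrix.compRingEquiv _ _ _ ∘ lax q c w (q⁻¹ * z)) j := by
    intro j
    ext ⟨a, σ⟩ ⟨b, τ⟩
    simp only [R12at, Matrix.of_apply, R12_apply]
    rfl
  exact congrArg List.prod (List.map_congr_left fun j _ => h j)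

lemma Bop_eq (q c : ℂ) {N : ℕ} (w : Fin N → ℂ) (z : ℂ) :
    Bop q c w z = mono q c w (q⁻¹ * z) 0 1 := by
  ext σ τ
  simp only [Bop, monodromy_eq, Matrix.of_apply]
  rfl

lemma R19_prod_eq (q : ℂ) {N : ℕ} (w : Fin N → ℂ) (z : ℂ) :
    ((List.finRange N).reverse.map fun j => R19at q (z / w j) j).prod =
      Matrix.compRingEquiv _ _ _ (mono19 q w z) := by
  rw [mono19, map_list_prod, List.map_map]
  rfl

lemma T2_eq (q : ℂ) {N : ℕ} (w : Fin N → ℂ) (z : ℂ) :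
    T2 q ![-1, 1, -1] w z = -mono19 q w z 0 0 + mono19 q w z 1 1 - mono19 q w z 2 2 := by
  have ho : (omegaAux ![-1, 1, -1] : Matrix (Fin 3 × (Fin N → Fin 3)) _ ℂ) =
      Matrix.diagonal fun p => (![-1, 1, -1] : Fin 3 → ℂ) p.1 := by
    ext p p'
    simp [omegaAux, Matrix.diagonal_apply]
  ext σ τ
  simp only [T2, R19_prod_eq, ho, Matrix.of_apply, Matrix.diagonal_mul, Fin.sum_univ_three]
  change -1 * mono19 q w z 0 0 σ τ + 1 * mono19 q w z 1 1 σ τ + -1 * mono19 q w z 2 2 σ τ = _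
  simp only [Matrix.sub_apply, Matrix.add_apply, Matrix.neg_apply]
  ring

/-! ### Global relations -/

lemma commute_lax (q c : ℂ) {N : ℕ} (w : Fin N → ℂ) (u v : ℂ) {i j : Fin N} (h : i ≠ j)
    (a b e f : Fin 2) : Commute (lax q c w u i a b) (lax q c w v j e f) :=
  commute_site h _ _

lemma amp₁_mul_amp₂_mono (q c : ℂ) {N : ℕ} (w : Fin N → ℂ) (u v : ℂ) :
    amp₁ (mono q c w u) * amp₂ (mono q c w v) =
      ((List.finRange N).reverse.map fun j => amp₁ (lax q c w u j) * amp₂ (lax q c w v j)).prod := by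
  rw [list_prod_mul_distrib _ _ _ (List.nodup_reverse.2 (List.nodup_finRange N))
    fun i j h => commute_amp (commute_lax q c w u v h), mono, mono, map_list_prod, map_list_prod,
    List.map_map, List.map_map]
  rfl

lemma amp₂_mul_amp₁_mono (q c : ℂ) {N : ℕ} (w : Fin N → ℂ) (u v : ℂ) :
    amp₂ (mono q c w v) * amp₁ (mono q c w u) =
      ((List.finRange N).reverse.map fun j => amp₂ (lax q c w v j) * amp₁ (lax q c w u j)).prod := by
  rw [list_prod_mul_distrib _ _ _ (List.nodup_reverse.2 (List.nodup_finRange N))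
    fun i j h => (commute_amp (commute_lax q c w u v h.symm)).symm, mono, mono, map_list_prod,
    map_list_prod, List.map_map, List.map_map]
  rfl

lemma rtt (q c : ℂ) (hq : q ≠ 0) (hc : c * c = br q * br (q^2)) {N : ℕ} (w : Fin N → ℂ)
    (hw : ∀ j, w j ≠ 0) (u v : ℂ) (hu : u ≠ 0) (hv : v ≠ 0) :
    (amp₂ (mono q c w v) * amp₁ (mono q c w u)) * (R11 q (u / v)).map (algebraMap ℂ _) =
      (R11 q (u / v)).map (algebraMap ℂ _) * (amp₁ (mono q c w u) * amp₂ (mono q c w v)) := by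
  rw [amp₁_mul_amp₂_mono, amp₂_mul_amp₁_mono]
  refine list_prod_intertwine _ _ _ (fun j => ?_) _
  have h := congrArg (fun M => M.map (site j))
    (rtt_local q c (u / v) (v / w j) hq (div_ne_zero hu hv) (div_ne_zero hv (hw j)) hc)
  have e : u / v * (v / w j) = u / w j := by field_simp
  rw [e] at h
  simp only [map_mul_algHom, amp₁_map, amp₂_map, map_algebraMap_map] at h
  exact h

lemma fusion (q c κ : ℂ) (hq : q ≠ 0) (hc : c * c = br q * br (q^2)) (hκ : κ * c = br q)
    (hκ' : c = κ * br (q^2)) {N : ℕ} (w : Fin N → ℂ) (hw : ∀ j, w j ≠ 0) (z : ℂ) (hz : z ≠ 0) :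
    (amp₁ (mono q c w (q⁻¹ * z)) * amp₂ (mono q c w z)) * (triplet κ).map (algebraMap ℂ _) =
      (triplet κ).map (algebraMap ℂ _) * mono19 q w z := by
  rw [amp₁_mul_amp₂_mono]
  refine list_prod_intertwine _ _ _ (fun j => ?_) _
  have h := congrArg (fun M => M.map (site j))
    (fusion_local q c κ (z / w j) hq (div_ne_zero hz (hw j)) hc hκ hκ')
  rw [← mul_div_assoc] at h
  simp only [map_mul_algHom, amp₁_map, amp₂_map, map_algebraMap_map] at h
  refine h.trans ((map_mul_algHom (site j) _ _).trans ?_)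
  rw [map_algebraMap_map]
  rfl

lemma singlet_mono (q c : ℂ) (hq : q ≠ 0) (hc : c * c = br q * br (q^2)) {N : ℕ} (w : Fin N → ℂ)
    (hw : ∀ j, w j ≠ 0) (z : ℂ) (hz : z ≠ 0) :
    (algebraMap ℂ (Matrix Unit Unit _) (∏ j, br (q⁻¹ * (z / w j)) * br (q^2 * (z / w j)))) *
        singlet.map (algebraMap ℂ (Matrix (Fin N → Fin 3) (Fin N → Fin 3) ℂ)) =
      singlet.map (algebraMap ℂ _) * (amp₁ (mono q c w (q⁻¹ * z)) * amp₂ (mono q c w z)) := by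
  have hp : ∏ j, br (q⁻¹ * (z / w j)) * br (q^2 * (z / w j)) =
      ((List.finRange N).reverse.map fun j => br (q⁻¹ * (z / w j)) * br (q^2 * (z / w j))).prod := by
    rw [List.map_reverse, List.prod_reverse, ← List.ofFn_eq_map, List.prod_ofFn]
  rw [amp₁_mul_amp₂_mono, hp, map_list_prod, List.map_map]
  refine list_prod_intertwine _ _ _ (fun j => ?_) _
  have h := congrArg (fun M => M.map (site j))
    (singlet_local q c (z / w j) hq (div_ne_zero hz (hw j)) hc)
  simp only [map_mul_algHom, map_algebraMap_map, algebraMap_map] at h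
  simp only [← mul_div_assoc q⁻¹] at h ⊢
  refine h.trans ((map_mul_algHom (site j) _ _).trans ?_)
  rw [map_algebraMap_map, map_mul_algHom, amp₁_map, amp₂_map]
  rfl

/-! ### Exchange relations -/

section Exchange

variable (q c : ℂ) {N : ℕ} (w : Fin N → ℂ)

lemma rtt_apply (hq : q ≠ 0) (hc : c * c = br q * br (q^2)) (hw : ∀ j, w j ≠ 0) (u v : ℂ)
    (hu : u ≠ 0) (hv : v ≠ 0) (p p' : Fin 2 × Fin 2) :
    ∑ r : Fin 2 × Fin 2, R11 q (u / v) r p' • (mono q c w v p.2 r.2 * mono q c w u p.1 r.1) =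
      ∑ r : Fin 2 × Fin 2, R11 q (u / v) p r •
        (mono q c w u r.1 p'.1 * mono q c w v r.2 p'.2) := by
  have h := congrFun (congrFun (rtt q c hq hc w hw u v hu hv) p) p'
  refine Eq.trans ?_ ((Matrix.mul_apply.symm.trans h).trans (Matrix.mul_apply.trans ?_)) <;>
  refine Finset.sum_congr rfl fun r _ => ?_
  · rw [amp₂_mul_amp₁, Matrix.map_apply, Algebra.algebraMap_eq_smul_one, mul_smul_comm, mul_one]
  · rw [amp₁_mul_amp₂, Matrix.map_apply, Algebra.algebraMap_eq_smul_one, smul_mul_assoc, one_mul]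

lemma exchange_AB (hq : q ≠ 0) (hc : c * c = br q * br (q^2)) (hw : ∀ j, w j ≠ 0) (u v : ℂ)
    (hu : u ≠ 0) (hv : v ≠ 0) :
    br (u / v) • (mono q c w v 0 0 * mono q c w u 0 1) =
      br (q * (u / v)) • (mono q c w u 0 1 * mono q c w v 0 0) -
        br q • (mono q c w v 0 1 * mono q c w u 0 0) := by
  have h := rtt_apply q c w hq hc hw u v hu hv (0, 0) (1, 0)
  simp [Fintype.sum_prod_type, R11] at h
  rw [← h]
  abel

lemma exchange_DB (hq : q ≠ 0) (hc : c * c = br q * br (q^2)) (hw : ∀ j, w j ≠ 0) (u v : ℂ)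
    (hu : u ≠ 0) (hv : v ≠ 0) :
    br (u / v) • (mono q c w u 1 1 * mono q c w v 0 1) =
      br (q * (u / v)) • (mono q c w v 0 1 * mono q c w u 1 1) -
        br q • (mono q c w u 0 1 * mono q c w v 1 1) := by
  have h := rtt_apply q c w hq hc hw u v hu hv (1, 0) (1, 1)
  simp [Fintype.sum_prod_type, R11] at h
  rw [h]
  abel

lemma exchange_BB (hq : q ≠ 0) (hc : c * c = br q * br (q^2)) (hw : ∀ j, w j ≠ 0) (u v : ℂ)
    (hu : u ≠ 0) (hv : v ≠ 0) :
    br (q * (u / v)) • (mono q c w v 0 1 * mono q c w u 0 1) =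
      br (q * (u / v)) • (mono q c w u 0 1 * mono q c w v 0 1) := by
  have h := rtt_apply q c w hq hc hw u v hu hv (0, 0) (1, 1)
  simpa [Fintype.sum_prod_type, R11] using h

lemma br_eq_zero_iff {x : ℂ} (hx : x ≠ 0) : br x = 0 ↔ x ^ 2 = 1 := by
  rw [br, sub_eq_zero, ← mul_left_inj' hx, inv_mul_cancel₀ hx, sq]

lemma commute_B (hq : q ≠ 0) (hc : c * c = br q * br (q^2)) (hc0 : c ≠ 0) (hw : ∀ j, w j ≠ 0)
    (u v : ℂ) (hu : u ≠ 0) (hv : v ≠ 0) :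
    Commute (mono q c w v 0 1) (mono q c w u 0 1) := by
  by_cases h : br (q * (u / v)) = 0
  · by_cases h' : br (q * (v / u)) = 0
    · rw [br_eq_zero_iff (by positivity)] at h h'
      refine absurd ?_ (mul_ne_zero hc0 hc0)
      rw [hc, (br_eq_zero_iff (pow_ne_zero 2 hq)).2, mul_zero]
      calc (q ^ 2) ^ 2 = (q * (u / v)) ^ 2 * (q * (v / u)) ^ 2 := by field_simp
        _ = 1 := by rw [h, h', one_mul]
    · exact (smul_right_injective _ h' (exchange_BB q c w hq hc hw v u hv hu)).symm
  · exact smul_right_injective _ h (exchange_BB q c w hq hc hw u v hu hv)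

end Exchange

/-! ### The reference state -/

lemma site_mulVec_vac {N : ℕ} (j : Fin N) (M : Matrix (Fin 3) (Fin 3) ℂ) (r : ℂ)
    (h : ∀ a, M a 0 = if a = 0 then r else 0) : site j M *ᵥ vac N = r • vac N := by
  funext σ
  rw [site_mulVec, Finset.sum_eq_single 0]
  · rw [h, Pi.smul_apply, smul_eq_mul]
    split_ifs with h0
    · rw [← h0, Function.update_eq_self]
    · have : vac N σ = 0 := if_neg fun e => h0 (by rw [e])
      rw [this]
      simp
  · intro x _ hx
    have : vac N (Function.update σ j x) = 0 :=
      if_neg fun e => hx (by simpa using congrFun e j)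
    rw [this, mul_zero]
  · simp

section Vacuum

variable (q c : ℂ) {N : ℕ} (w : Fin N → ℂ) (z : ℂ)

lemma lax_mulVec_vac (j : Fin N) :
    lax q c w z j 0 0 *ᵥ vac N = br (q^2 * (z / w j)) • vac N ∧
      lax q c w z j 1 0 *ᵥ vac N = 0 ∧ lax q c w z j 1 1 *ᵥ vac N = br (z / w j) • vac N := by
  refine ⟨site_mulVec_vac j _ _ fun a => ?_, ?_, site_mulVec_vac j _ _ fun a => ?_⟩
  · fin_cases a <;> simp [laxLocal]
  · rw [← zero_smul ℂ (vac N)]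
    refine site_mulVec_vac j _ _ fun a => ?_
    fin_cases a <;> simp [laxLocal]
  · fin_cases a <;> simp [laxLocal]

lemma list_prod_lax_mulVec_vac (l : List (Fin N)) (hl : l.Nodup) :
    (l.map (lax q c w z)).prod 0 0 *ᵥ vac N =
        (l.map fun j => br (q^2 * (z / w j))).prod • vac N ∧
      (l.map (lax q c w z)).prod 1 0 *ᵥ vac N = 0 ∧
      (l.map (lax q c w z)).prod 1 1 *ᵥ vac N = (l.map fun j => br (z / w j)).prod • vac N := by
  induction l with
  | nil => simp
  | cons j l ih =>
    obtain ⟨hj, hl⟩ := List.nodup_cons.1 hl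
    obtain ⟨h0, h1, h2⟩ := ih hl
    obtain ⟨k0, k1, k2⟩ := lax_mulVec_vac q c w z j
    have hcomm : Commute (amp₁ (lax q c w z j)) (amp₂ (l.map (lax q c w z)).prod) := by
      rw [map_list_prod, List.map_map]
      refine Commute.list_prod_right _ _ fun a ha => ?_
      obtain ⟨i, hi, rfl⟩ := List.mem_map.1 ha
      exact commute_amp (commute_lax q c w z z fun e => hj (e ▸ hi))
    have h := congrFun (congrFun hcomm.eq (1, 0)) (0, 1)
    rw [amp₁_mul_amp₂, amp₂_mul_amp₁] at h
    simp only [List.map_cons, List.prod_cons]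
    generalize (l.map (lax q c w z)).prod = M at *
    have hm (a b : Fin 2) : (lax q c w z j * M) a b =
        lax q c w z j a 0 * M 0 b + lax q c w z j a 1 * M 1 b :=
      Matrix.mul_apply.trans (Fin.sum_univ_two _)
    refine ⟨?_, ?_, ?_⟩
    · rw [hm, Matrix.add_mulVec, ← Matrix.mulVec_mulVec, ← Matrix.mulVec_mulVec, h0, h1,
        Matrix.mulVec_smul, k0, Matrix.mulVec_zero, add_zero, smul_smul, mul_comm]
    · rw [hm, Matrix.add_mulVec, ← Matrix.mulVec_mulVec, ← Matrix.mulVec_mulVec, h0, h1,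
        Matrix.mulVec_smul, k1, Matrix.mulVec_zero, smul_zero, add_zero]
    · rw [hm, h, Matrix.add_mulVec, ← Matrix.mulVec_mulVec, ← Matrix.mulVec_mulVec, h2, k1,
        Matrix.mulVec_smul, k2, Matrix.mulVec_zero, zero_add, smul_smul, mul_comm]

lemma mono_mulVec_vac :
    mono q c w z 0 0 *ᵥ vac N = (∏ j, br (q^2 * (z / w j))) • vac N ∧
      mono q c w z 1 1 *ᵥ vac N = (∏ j, br (z / w j)) • vac N := by
  have hp (f : Fin N → ℂ) : ((List.finRange N).reverse.map f).prod = ∏ j, f j := by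
    rw [List.map_reverse, List.prod_reverse, ← List.ofFn_eq_map, List.prod_ofFn]
  obtain ⟨h0, -, h2⟩ := list_prod_lax_mulVec_vac q c w z (List.finRange N).reverse
    (List.nodup_reverse.2 (List.nodup_finRange N))
  rw [hp] at h0 h2
  exact ⟨h0, h2⟩

end Vacuum

/-! ### Action of the diagonal operators on the Bethe vector -/

lemma br_div {a b : ℂ} (ha : a ≠ 0) (hb : b ≠ 0) : br (a / b) = (a ^ 2 - b ^ 2) / (a * b) := by
  rw [br]
  field_simp

lemma br_mul_div {q a b : ℂ} (hq : q ≠ 0) (ha : a ≠ 0) (hb : b ≠ 0) :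
    br (q * (a / b)) = (q ^ 2 * a ^ 2 - b ^ 2) / (q * a * b) := by
  rw [br]
  field_simp

/-- The coefficient of the wanted term in the exchange relations. -/
def wanted (q y u : ℂ) : ℂ := (q ^ 2 * u ^ 2 - y ^ 2) / (q * (u ^ 2 - y ^ 2))

/-- The coefficient of the unwanted term in the exchange relations. -/
def unwanted (q y u : ℂ) : ℂ := -(br q * (u * y)) / (u ^ 2 - y ^ 2)

lemma wanted_unwanted {q y u t : ℂ} (hq : q ≠ 0) (hyu : y ^ 2 ≠ u ^ 2)
    (hyt : y ^ 2 ≠ t ^ 2) (hut : u ^ 2 ≠ t ^ 2) :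
    wanted q y u * unwanted q y t + unwanted q y u * unwanted q u t =
      unwanted q y t * wanted q t u := by
  have h1 := sub_ne_zero.2 hyu.symm
  have h2 := sub_ne_zero.2 hyt.symm
  have h3 := sub_ne_zero.2 hut.symm
  have h4 := sub_ne_zero.2 hut
  simp only [wanted, unwanted, br]
  field_simp
  ring

lemma wanted_unwanted' {q y u t : ℂ} (hq : q ≠ 0) (hyu : y ^ 2 ≠ u ^ 2)
    (hyt : y ^ 2 ≠ t ^ 2) (hut : u ^ 2 ≠ t ^ 2) :
    wanted q u y * unwanted q t y + unwanted q u y * unwanted q t u =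
      unwanted q t y * wanted q u t := by
  have h1 := sub_ne_zero.2 hyu
  have h2 := sub_ne_zero.2 hyt
  have h3 := sub_ne_zero.2 hut.symm
  have h4 := sub_ne_zero.2 hut
  simp only [wanted, unwanted, br]
  field_simp
  ring

section Bethe

variable (q c : ℂ) {N : ℕ} (w : Fin N → ℂ)

lemma exchange_AB' (hq : q ≠ 0) (hc : c * c = br q * br (q^2)) (hw : ∀ j, w j ≠ 0) (y u : ℂ)
    (hy : y ≠ 0) (hu : u ≠ 0) (h : y ^ 2 ≠ u ^ 2) :
    mono q c w (q⁻¹ * y) 0 0 * mono q c w (q⁻¹ * u) 0 1 =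
      wanted q y u • (mono q c w (q⁻¹ * u) 0 1 * mono q c w (q⁻¹ * y) 0 0) +
        unwanted q y u • (mono q c w (q⁻¹ * y) 0 1 * mono q c w (q⁻¹ * u) 0 0) := by
  have hi := inv_ne_zero hq
  have e := exchange_AB q c w hq hc hw (q⁻¹ * u) (q⁻¹ * y) (mul_ne_zero hi hu) (mul_ne_zero hi hy)
  rw [mul_div_mul_left _ _ hi, br_div hu hy, br_mul_div hq hu hy] at e
  have h' := sub_ne_zero.2 h.symm
  have hr : (u ^ 2 - y ^ 2) / (u * y) ≠ 0 := div_ne_zero h' (mul_ne_zero hu hy)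
  refine smul_right_injective _ hr (e.trans ?_)
  rw [sub_eq_add_neg, ← neg_smul]
  simp only [smul_add, smul_smul]
  congr 2 <;> simp only [wanted, unwanted] <;> field_simp

lemma exchange_DB' (hq : q ≠ 0) (hc : c * c = br q * br (q^2)) (hw : ∀ j, w j ≠ 0) (y u : ℂ)
    (hy : y ≠ 0) (hu : u ≠ 0) (h : y ^ 2 ≠ u ^ 2) :
    mono q c w (q⁻¹ * y) 1 1 * mono q c w (q⁻¹ * u) 0 1 =
      wanted q u y • (mono q c w (q⁻¹ * u) 0 1 * mono q c w (q⁻¹ * y) 1 1) +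
        unwanted q u y • (mono q c w (q⁻¹ * y) 0 1 * mono q c w (q⁻¹ * u) 1 1) := by
  have hi := inv_ne_zero hq
  have e := exchange_DB q c w hq hc hw (q⁻¹ * y) (q⁻¹ * u) (mul_ne_zero hi hy) (mul_ne_zero hi hu)
  rw [mul_div_mul_left _ _ hi, br_div hy hu, br_mul_div hq hy hu] at e
  have h' := sub_ne_zero.2 h
  have hr : (y ^ 2 - u ^ 2) / (y * u) ≠ 0 := div_ne_zero h' (mul_ne_zero hy hu)
  refine smul_right_injective _ hr (e.trans ?_)
  rw [sub_eq_add_neg, ← neg_smul]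
  simp only [smul_add, smul_smul]
  congr 2 <;> simp only [wanted, unwanted] <;> field_simp

lemma br_mul_wanted {q y u : ℂ} (hq : q ≠ 0) (hy : y ≠ 0) (hu : u ≠ 0) (h : y ^ 2 ≠ u ^ 2) :
    br (q ^ 2 * (q⁻¹ * y / u)) * wanted q y u = br (q⁻¹ * y / u) * wanted q u y := by
  have h1 := sub_ne_zero.2 h
  have h2 := sub_ne_zero.2 h.symm
  simp only [wanted, br]
  field_simp
  ring

lemma unwanted_swap (q y u : ℂ) : unwanted q y u = -unwanted q u y := by
  rw [unwanted, unwanted, ← neg_sub (y ^ 2), div_neg, mul_comm u]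

lemma A_sub_D_mulVec_bethe_of_generic (hq : q ≠ 0) (hc : c * c = br q * br (q^2)) (hc0 : c ≠ 0)
    (hw : ∀ j, w j ≠ 0) (hww : ∀ i j, i ≠ j → w i ^ 2 ≠ w j ^ 2) (y : ℂ) (hy : y ≠ 0)
    (hyw : ∀ j, y ^ 2 ≠ w j ^ 2) :
    (mono q c w (q⁻¹ * y) 0 0 - mono q c w (q⁻¹ * y) 1 1) *ᵥ bethe q c w = 0 := by
  have hi := inv_ne_zero hq
  let B : {u : ℂ // u ≠ 0} → Module.End ℂ ((Fin N → Fin 3) → ℂ) := fun u =>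
    Matrix.toLin' (mono q c w (q⁻¹ * u) 0 1)
  have hBB (u v) : Commute (B u) (B v) := by
    have := commute_B q c w hq hc hc0 hw (q⁻¹ * v.1) (q⁻¹ * u.1) (mul_ne_zero hi v.2)
      (mul_ne_zero hi u.2)
    exact (Matrix.toLin'_mul _ _).symm.trans
      ((congrArg Matrix.toLin' this.eq).trans (Matrix.toLin'_mul _ _))
  let b : Fin N → Module.End ℂ ((Fin N → Fin 3) → ℂ) := fun i => B ⟨w i, hw i⟩
  have hb (S : Finset (Fin N)) : (S : Set (Fin N)).Pairwise (Function.onFun Commute b) :=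
    fun i _ j _ _ => hBB _ _
  let β : Finset (Fin N) → (Fin N → Fin 3) → ℂ := fun S => S.noncommProd b (hb S) (vac N)
  have hβ0 : β ∅ = vac N := rfl
  have hβ : ∀ i S, i ∉ S → β (insert i S) = B ⟨w i, hw i⟩ (β S) := by
    intro i S hiS
    simp only [β]
    rw [Finset.noncommProd_insert_of_notMem _ _ _ _ hiS]
    rfl
  have hbethe : β univ = bethe q c w := by
    have h1 : (univ : Finset (Fin N)) = (List.finRange N).toFinset := by simp
    have h2 : (univ : Finset (Fin N)).noncommProd b (hb univ) =
        ((List.finRange N).map b).prod := by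
      rw [← Finset.noncommProd_toFinset _ b (by rw [← h1]; exact hb _) (List.nodup_finRange N)]
      simp only [h1]
    simp only [β, bethe, h2, ← Matrix.toLin'_apply, Bop_eq]
    have h3 := map_list_prod (Matrix.toLinAlgEquiv' (R := ℂ) (n := Fin N → Fin 3))
      ((List.finRange N).map fun j => mono q c w (q⁻¹ * w j) 0 1)
    rw [List.map_map] at h3
    exact (LinearMap.congr_fun h3 (vac N)).symm
  have hA := offShell (fun u : {u : ℂ // u ≠ 0} => Matrix.toLin' (mono q c w (q⁻¹ * u) 0 0)) B
    (fun u => ∏ j, br (q^2 * (q⁻¹ * u / w j))) (fun y u => wanted q y u)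
    (fun y u => unwanted q y u) (fun y u => y.1 ^ 2 ≠ u.1 ^ 2) hBB
    (fun y u h => by
      have := congrArg Matrix.toLin' (exchange_AB' q c w hq hc hw y u y.2 u.2 h)
      simp only [Matrix.toLin'_mul, map_add, map_smul] at this
      exact this)
    (fun y u t h1 h2 h3 _ => wanted_unwanted hq h1 h2 h3)
    (fun i => ⟨w i, hw i⟩) hww β
    (fun y => by rw [hβ0]; exact (mono_mulVec_vac q c w (q⁻¹ * y)).1) hβ univ ⟨y, hy⟩
    (fun j _ => hyw j)
  have hD := offShell (fun u : {u : ℂ // u ≠ 0} => Matrix.toLin' (mono q c w (q⁻¹ * u) 1 1)) B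
    (fun u => ∏ j, br (q⁻¹ * u / w j)) (fun y u => wanted q u y)
    (fun y u => unwanted q u y) (fun y u => y.1 ^ 2 ≠ u.1 ^ 2) hBB
    (fun y u h => by
      have := congrArg Matrix.toLin' (exchange_DB' q c w hq hc hw y u y.2 u.2 h)
      simp only [Matrix.toLin'_mul, map_add, map_smul] at this
      exact this)
    (fun y u t h1 h2 h3 _ => wanted_unwanted' hq h1 h2 h3)
    (fun i => ⟨w i, hw i⟩) hww β
    (fun y => by rw [hβ0]; exact (mono_mulVec_vac q c w (q⁻¹ * y)).2) hβ univ ⟨y, hy⟩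
    (fun j _ => hyw j)
  rw [hbethe, Matrix.toLin'_apply] at hA hD
  rw [Matrix.sub_mulVec, hA, hD, sub_eq_zero]
  congr 1
  · rw [← Finset.prod_mul_distrib, ← Finset.prod_mul_distrib]
    congr 1
    exact Finset.prod_congr rfl fun j _ => br_mul_wanted hq hy (hw j) (hyw j)
  · refine Finset.sum_congr rfl fun i _ => ?_
    congr 1
    simp only
    rw [unwanted_swap q y, ← Finset.mul_prod_erase univ _ (mem_univ i),
      ← Finset.mul_prod_erase univ (fun j => br (q⁻¹ * w i / w j)) (mem_univ i)]
    have e1 : br (q^2 * (q⁻¹ * w i / w i)) = -br (q⁻¹ * w i / w i) := by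
      have := hw i
      simp only [br]
      field_simp
      ring
    have e2 : (∏ k ∈ univ.erase i, br (q^2 * (q⁻¹ * w i / w k))) *
        ∏ k ∈ univ.erase i, wanted q (w i) (w k) =
        (∏ k ∈ univ.erase i, br (q⁻¹ * w i / w k)) *
          ∏ k ∈ univ.erase i, wanted q (w k) (w i) := by
      rw [← Finset.prod_mul_distrib, ← Finset.prod_mul_distrib]
      exact Finset.prod_congr rfl fun k hk =>
        br_mul_wanted hq (hw i) (hw k) (hww i k (Finset.ne_of_mem_erase hk).symm)
    rw [e1]
    linear_combination br (q⁻¹ * w i / w i) * unwanted q (w i) y * e2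

end Bethe

/-! ### Removal of the genericity assumption -/

section Continuity

variable (q c : ℂ) {N : ℕ}

lemma continuous_mono {T : Type*} [TopologicalSpace T] {W : T → Fin N → ℂ} {f : T → ℂ}
    (hW : ∀ j, Continuous fun t => W t j) (hW0 : ∀ t j, W t j ≠ 0) (hf : Continuous f)
    (hf0 : ∀ t, f t ≠ 0) (hq : q ≠ 0) : Continuous fun t => mono q c (W t) (f t) := by
  refine continuous_list_prod _ fun j _ => ?_
  have hr : Continuous fun t => f t / W t j := hf.div (hW j) (hW0 · j)
  have hb (x : ℂ) (hx : x ≠ 0) : Continuous fun t => br (x * (f t / W t j)) :=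
    (continuous_const.mul hr).sub ((continuous_const.mul hr).inv₀
      fun t => mul_ne_zero hx (div_ne_zero (hf0 t) (hW0 t j)))
  have h1 := hb 1 one_ne_zero
  have h2 := hb q hq
  have h3 := hb (q ^ 2) (pow_ne_zero 2 hq)
  simp only [one_mul] at h1
  have hs : Continuous (site j) := (site j).toLinearMap.continuous_of_finiteDimensional
  refine Continuous.matrix_map ?_ hs
  refine continuous_matrix fun a b => continuous_matrix fun s t => ?_
  fin_cases a <;> fin_cases b <;> fin_cases s <;> fin_cases t <;>
    first
    | exact h1
    | exact h2
    | exact h3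
    | exact continuous_const

lemma subsingleton_mul_exp_pow_eq {a b : ℂ} (ha : a ≠ 0) (hb : b ≠ 0) {m n : ℕ} (h : m ≠ n) :
    {t : ℝ | a * (Real.exp t : ℂ) ^ m = b * (Real.exp t : ℂ) ^ n}.Subsingleton := by
  intro t ht s hs
  simp only [Set.mem_ofPred_eq] at ht hs
  have h1 : (a * b) * ((Real.exp t : ℂ) ^ m * (Real.exp s : ℂ) ^ n) =
      (a * b) * ((Real.exp s : ℂ) ^ m * (Real.exp t : ℂ) ^ n) := by
    linear_combination b * (Real.exp s : ℂ) ^ n * ht - b * (Real.exp t : ℂ) ^ n * hs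
  have h2 := mul_left_cancel₀ (mul_ne_zero ha hb) h1
  norm_cast at h2
  simp only [← Real.exp_nat_mul, ← Real.exp_add] at h2
  have h3 := Real.exp_injective h2
  have h4 : (m : ℝ) - n ≠ 0 := sub_ne_zero.2 (Nat.cast_injective.ne h)
  refine mul_left_cancel₀ h4 ?_
  linear_combination h3

lemma A_sub_D_mulVec_bethe (hq : q ≠ 0) (hc : c * c = br q * br (q^2)) (hc0 : c ≠ 0)
    (w : Fin N → ℂ) (hw : ∀ j, w j ≠ 0) (z : ℂ) (hz : z ≠ 0) :
    (mono q c w z 0 0 - mono q c w z 1 1) *ᵥ bethe q c w = 0 := by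
  have hi := inv_ne_zero hq
  let W : ℝ → Fin N → ℂ := fun t j => w j * (Real.exp t : ℂ) ^ ((j : ℕ) + 1)
  have hexp (t : ℝ) : (Real.exp t : ℂ) ≠ 0 := Complex.ofReal_ne_zero.2 (Real.exp_ne_zero t)
  have hW0 (t : ℝ) (j : Fin N) : W t j ≠ 0 := mul_ne_zero (hw j) (pow_ne_zero _ (hexp t))
  have hW (j : Fin N) : Continuous fun t => W t j :=
    continuous_const.mul ((Complex.continuous_ofReal.comp Real.continuous_exp).pow _)
  have hM : Continuous fun t => mono q c (W t) z :=
    continuous_mono q c hW hW0 continuous_const (fun _ => hz) hq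
  have hB : Continuous fun t => bethe q c (W t) := by
    simp only [bethe, Bop_eq]
    refine Continuous.matrix_mulVec (continuous_list_prod _ fun j _ => ?_) continuous_const
    exact (continuous_mono q c hW hW0 (continuous_const.mul (hW j))
      (fun t => mul_ne_zero hi (hW0 t j)) hq).matrix_elem 0 1
  have hF : Continuous fun t =>
      (mono q c (W t) z 0 0 - mono q c (W t) z 1 1) *ᵥ bethe q c (W t) :=
    Continuous.matrix_mulVec ((hM.matrix_elem 0 0).sub (hM.matrix_elem 1 1)) hB
  let S₁ : Set ℝ := ⋃ j : Fin N, {t | (q * z) ^ 2 * (Real.exp t : ℂ) ^ 0 =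
    w j ^ 2 * (Real.exp t : ℂ) ^ (2 * ((j : ℕ) + 1))}
  let S₂ : Set ℝ := ⋃ i : Fin N, ⋃ j : Fin N, ⋃ _ : i ≠ j,
    {t | w i ^ 2 * (Real.exp t : ℂ) ^ (2 * ((i : ℕ) + 1)) =
      w j ^ 2 * (Real.exp t : ℂ) ^ (2 * ((j : ℕ) + 1))}
  have hS : (S₁ ∪ S₂).Countable := by
    refine Set.Countable.union (Set.countable_iUnion fun j => ?_)
      (Set.countable_iUnion fun i => Set.countable_iUnion fun j => Set.countable_iUnion fun h => ?_)
    · exact (subsingleton_mul_exp_pow_eq (pow_ne_zero 2 (mul_ne_zero hq hz))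
        (pow_ne_zero 2 (hw j)) (by omega)).countable
    · have h' : (i : ℕ) ≠ j := fun e => h (Fin.ext e)
      exact (subsingleton_mul_exp_pow_eq (pow_ne_zero 2 (hw i)) (pow_ne_zero 2 (hw j))
        (by omega)).countable
  have h0 := (hF.ext_on (hS.dense_compl ℝ) continuous_const (g := fun _ => 0) fun t ht => ?_)
  · have h1 := congrFun h0 0
    simpa [W] using h1
  · have ht1 : t ∉ S₁ := fun h => ht (Or.inl h)
    have ht2 : t ∉ S₂ := fun h => ht (Or.inr h)
    have h1 := A_sub_D_mulVec_bethe_of_generic q c (W t) hq hc hc0 (hW0 t)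
      (fun i j hij e => ht2 ?_) (q * z) (mul_ne_zero hq hz) fun j e => ht1 ?_
    · rwa [inv_mul_cancel_left₀ hq] at h1
    · refine Set.mem_iUnion.2 ⟨i, Set.mem_iUnion.2 ⟨j, Set.mem_iUnion.2 ⟨hij, ?_⟩⟩⟩
      simp only [W, mul_pow, ← pow_mul, mul_comm _ 2] at e
      exact e
    · refine Set.mem_iUnion.2 ⟨j, ?_⟩
      simp only [W, mul_pow, ← pow_mul, mul_comm _ 2] at e
      simpa [mul_pow] using e

end Continuity

/-! ### The transfer matrix in terms of the monodromy matrix -/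

section Transfer

variable (q c : ℂ) {N : ℕ} (w : Fin N → ℂ)

lemma T2_eq_A_sub_D (hq : q ≠ 0) (hc : c * c = br q * br (q^2)) (hc0 : c ≠ 0)
    (hw : ∀ j, w j ≠ 0) (z : ℂ) (hz : z ≠ 0) :
    T2 q ![-1, 1, -1] w z =
      -((mono q c w (q⁻¹ * z) 0 0 - mono q c w (q⁻¹ * z) 1 1) *
        (mono q c w z 0 0 - mono q c w z 1 1)) -
      (∏ j, br (q⁻¹ * (z / w j)) * br (q^2 * (z / w j))) • (1 : Matrix _ _ ℂ) := by
  have hq2 : br (q^2) ≠ 0 := fun h => mul_ne_zero hc0 hc0 (by rw [hc, h, mul_zero])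
  have hκ0 : c / br (q^2) ≠ 0 := div_ne_zero hc0 hq2
  have hf := fusion q c (c / br (q^2)) hq hc
    (by rw [div_mul_eq_mul_div, hc, mul_div_cancel_right₀ _ hq2])
    (div_mul_cancel₀ c hq2).symm w hw z hz
  have hs := singlet_mono q c hq hc w hw z hz
  have hf' (p : Fin 2 × Fin 2) (a : Fin 3) :=
    Matrix.mul_apply.symm.trans ((congrFun (congrFun hf p) a).trans Matrix.mul_apply)
  have hs' (p : Fin 2 × Fin 2) :=
    Matrix.mul_apply.symm.trans ((congrFun (congrFun hs ()) p).trans Matrix.mul_apply)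
  simp only [amp₁_mul_amp₂, Matrix.map_apply, Algebra.algebraMap_eq_smul_one, mul_smul_comm,
    smul_mul_assoc, mul_one, one_mul] at hf' hs'
  have f0 := hf' (0, 0) 0
  have f2 := hf' (1, 1) 2
  have f1 := hf' (0, 1) 1
  have s1 := hs' (1, 0)
  simp [Fintype.sum_prod_type, triplet] at f0 f1 f2
  simp [Fintype.sum_prod_type, singlet] at s1
  rw [← smul_add] at f1
  have f1' := smul_right_injective _ hκ0 f1
  have e : mono q c w (q⁻¹ * z) 1 1 * mono q c w z 0 0 =
      mono q c w (q⁻¹ * z) 0 1 * mono q c w z 1 0 +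
        (∏ j, br (q⁻¹ * (z / w j)) * br (q^2 * (z / w j))) • (1 : Matrix _ _ ℂ) := by
    rw [← neg_neg ((∏ j, br (q⁻¹ * (z / w j)) * br (q^2 * (z / w j))) • (1 : Matrix _ _ ℂ)), s1]
    abel
  rw [T2_eq, ← f0, ← f2, ← f1', sub_mul, mul_sub, mul_sub, e]
  abel

lemma mono_zero_one_eq_zero (z : ℂ) : mono q 0 w z 0 1 = 0 := by
  have h : ∀ l : List (Fin N), (l.map (lax q 0 w z)).prod 0 1 = 0 := by
    intro l
    induction l with
    | nil => simp
    | cons j l ih =>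
      have hj : lax q 0 w z j 0 1 = 0 := by
        have : laxLocal q 0 (z / w j) 0 1 = 0 := by
          ext s t
          fin_cases s <;> fin_cases t <;> rfl
        simp [lax, this]
      rw [List.map_cons, List.prod_cons]
      refine Matrix.mul_apply.trans ?_
      rw [Fin.sum_univ_two, ih, hj, mul_zero, zero_mul, add_zero]
  exact h _

lemma bethe_zero (hN : 1 ≤ N) : bethe q 0 w = 0 := by
  rw [bethe, List.prod_eq_zero, Matrix.zero_mulVec]
  exact List.mem_map.2 ⟨⟨0, hN⟩, List.mem_finRange _, by rw [Bop_eq, mono_zero_one_eq_zero]⟩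

end Transfer

/-- For twist angle φ = π (twist Ω = diag(−1,1,−1)), the transfer matrix of the
nineteen-vertex model has the Bethe vector as eigenvector with the simple eigenvalue
`(−1)^{N+1} ∏_j [q w_j/z][q² z/w_j]`. -/
theorem stmt2 (q c : ℂ) (hq : q ≠ 0) (hc : c^2 = br q * br (q^2))
    (N : ℕ) (hN : 1 ≤ N) (w : Fin N → ℂ) (hw : ∀ j, w j ≠ 0)
    (z : ℂ) (hz : z ≠ 0) :
    (T2 q ![-1, 1, -1] w z).mulVec (bethe q c w) =
      ((-1 : ℂ)^(N+1) * ∏ j, br (q * w j / z) * br (q^2 * z / w j)) • bethe q c w := by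
  by_cases hc0 : c = 0
  · subst hc0
    rw [bethe_zero q w hN, Matrix.mulVec_zero, smul_zero]
  · rw [sq] at hc
    have hp : ∏ j, br (q⁻¹ * (z / w j)) * br (q^2 * (z / w j)) =
        (-1) ^ N * ∏ j, br (q * w j / z) * br (q^2 * z / w j) := by
      have h1 : (-1 : ℂ) ^ N = ∏ _j : Fin N, -1 := by simp
      rw [h1, ← Finset.prod_mul_distrib]
      refine Finset.prod_congr rfl fun j _ => ?_
      have := hw j
      simp only [br]
      field_simp
      ring
    rw [T2_eq_A_sub_D q c w hq hc hc0 hw z hz, Matrix.sub_mulVec, Matrix.neg_mulVec,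
      ← Matrix.mulVec_mulVec, A_sub_D_mulVec_bethe q c hq hc hc0 w hw z hz, Matrix.mulVec_zero,
      neg_zero, zero_sub, Matrix.smul_mulVec, Matrix.one_mulVec, hp, ← neg_smul, pow_succ]
    congr 1
    ring

end
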